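/- For every instance with 3 agents, a finite set M of indivisible chores, and additive bi-valued cost functions — i.e., there exist constants a, b ≥ 0 such that c_i(e) ∈ {a, b} for every agent i and item e — there exists an EFX allocation: an allocation (X_1, X_2, X_3) of M such that for all agents i, j and every e ∈ X_i, c_i(X_i \ {e}) ≤ c_i(X_j). -/

import Mathlib

open Finset

section EFX

variable {ι : Type*} [DecidableEq ι]

/-- An agent with cost function `u` holding `A` does not envy the holder of `B` once any single
chore of `A` is removed. -/
def EFXToward (u : ι → ℝ) (A B : Finset ι) : Prop :=
  ∀ e ∈ A, ∑ f ∈ A.erase e, u f ≤ ∑ f ∈ B, u f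

/-- `A`, `B`, `C` is an EFX allocation of `M` to agents with cost functions `u`, `v`, `w`. -/
structure IsEFXAllocation (u v w : ι → ℝ) (M A B C : Finset ι) : Prop where
  disjoint_AB : Disjoint A B
  disjoint_AC : Disjoint A C
  disjoint_BC : Disjoint B C
  union_eq : A ∪ B ∪ C = M
  fair_AB : EFXToward u A B
  fair_AC : EFXToward u A C
  fair_BA : EFXToward v B A
  fair_BC : EFXToward v B C
  fair_CA : EFXToward w C A
  fair_CB : EFXToward w C B

/-- Three agents with cost functions `u`, `v`, `w` have an EFX allocation of `M`. -/
def HasEFX (u v w : ι → ℝ) (M : Finset ι) : Prop :=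
  ∃ A B C, IsEFXAllocation u v w M A B C

variable {u v w : ι → ℝ} {M A B C : Finset ι} {e : ι}

theorem IsEFXAllocation.swap_left (h : IsEFXAllocation u v w M A B C) :
    IsEFXAllocation v u w M B A C where
  disjoint_AB := h.disjoint_AB.symm
  disjoint_AC := h.disjoint_BC
  disjoint_BC := h.disjoint_AC
  union_eq := by rw [union_comm B A, h.union_eq]
  fair_AB := h.fair_BA
  fair_AC := h.fair_BC
  fair_BA := h.fair_AB
  fair_BC := h.fair_AC
  fair_CA := h.fair_CB
  fair_CB := h.fair_CA

theorem IsEFXAllocation.swap_right (h : IsEFXAllocation u v w M A B C) :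
    IsEFXAllocation u w v M A C B where
  disjoint_AB := h.disjoint_AC
  disjoint_AC := h.disjoint_AB
  disjoint_BC := h.disjoint_BC.symm
  union_eq := by rw [union_right_comm, h.union_eq]
  fair_AB := h.fair_AC
  fair_AC := h.fair_AB
  fair_BA := h.fair_CA
  fair_BC := h.fair_CB
  fair_CA := h.fair_BA
  fair_CB := h.fair_BC

theorem HasEFX.swap_left (h : HasEFX u v w M) : HasEFX v u w M := by
  obtain ⟨A, B, C, h⟩ := h
  exact ⟨_, _, _, h.swap_left⟩

theorem HasEFX.swap_right (h : HasEFX u v w M) : HasEFX u w v M := by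
  obtain ⟨A, B, C, h⟩ := h
  exact ⟨_, _, _, h.swap_right⟩

theorem EFXToward.of_le (hu : ∀ f, 0 ≤ u f) (h : ∑ f ∈ A, u f ≤ ∑ f ∈ B, u f) :
    EFXToward u A B := fun e _ =>
  (sum_le_sum_of_subset_of_nonneg (erase_subset e A) fun f _ _ => hu f).trans h

theorem EFXToward.mono (h : EFXToward u A B) (hBC : ∑ f ∈ B, u f ≤ ∑ f ∈ C, u f) :
    EFXToward u A C := fun e he => (h e he).trans hBC

theorem EFXToward.insert_of_le (heA : e ∉ A) (hmin : ∀ f ∈ A, u e ≤ u f)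
    (h : ∑ f ∈ A, u f ≤ ∑ f ∈ B, u f) : EFXToward u (insert e A) B := by
  intro g hg
  have h1 := sum_erase_add _ u hg
  rw [sum_insert heA] at h1
  rcases mem_insert.1 hg with rfl | hg
  · linarith
  · linarith [hmin g hg]

/-- Giving each of two agents a chore preserves the fairness of the first towards the second if
the second receives a chore that is maximal for the first. -/
theorem EFXToward.insert_insert {d : ι} (h : EFXToward u A B) (hu : ∀ f, 0 ≤ u f)
    (heA : e ∉ A) (hdB : d ∉ B) (hmax : ∀ f ∈ A, u f ≤ u d) (hed : u e ≤ u d) :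
    EFXToward u (insert e A) (insert d B) := by
  intro g hg
  have h1 := sum_erase_add _ u hg
  rw [sum_insert heA] at h1
  rw [sum_insert hdB]
  rcases mem_insert.1 hg with rfl | hg
  · rcases A.eq_empty_or_nonempty with rfl | ⟨k, hk⟩
    · have := sum_nonneg fun f (_ : f ∈ B) => hu f
      simp only [sum_empty] at h1
      linarith [hu d]
    · have := sum_erase_add _ u hk
      linarith [h k hk, hmax k hk]
  · have := sum_erase_add _ u hg
    linarith [h g hg]

theorem sum_le_sum_insert (hu : ∀ f, 0 ≤ u f) (e : ι) (A : Finset ι) :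
    ∑ f ∈ A, u f ≤ ∑ f ∈ insert e A, u f :=
  sum_le_sum_of_subset_of_nonneg (subset_insert e A) fun f _ _ => hu f

/-- A chore that is minimal for an envy-free agent can be given to that agent. -/
theorem IsEFXAllocation.insert_of_le (h : IsEFXAllocation u v w M A B C) (hv : ∀ f, 0 ≤ v f)
    (hw : ∀ f, 0 ≤ w f) (heM : e ∉ M) (hmin : ∀ f ∈ M, u e ≤ u f)
    (hAB : ∑ f ∈ A, u f ≤ ∑ f ∈ B, u f) (hAC : ∑ f ∈ A, u f ≤ ∑ f ∈ C, u f) :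
    IsEFXAllocation u v w (insert e M) (insert e A) B C := by
  have hM := h.union_eq
  subst hM
  simp only [mem_union, not_or] at heM
  have hA : ∀ f ∈ A, u e ≤ u f := fun f hf => hmin f (by simp [hf])
  exact
    { disjoint_AB := disjoint_insert_left.2 ⟨heM.1.2, h.disjoint_AB⟩
      disjoint_AC := disjoint_insert_left.2 ⟨heM.2, h.disjoint_AC⟩
      disjoint_BC := h.disjoint_BC
      union_eq := by simp [insert_union]
      fair_AB := .insert_of_le heM.1.1 hA hAB
      fair_AC := .insert_of_le heM.1.1 hA hAC
      fair_BA := h.fair_BA.mono (sum_le_sum_insert hv e A)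
      fair_BC := h.fair_BC
      fair_CA := h.fair_CA.mono (sum_le_sum_insert hw e A)
      fair_CB := h.fair_CB }

/-- If the third agent is envy-free but prefers the bundle of the first one once `e` is added to
its own bundle, then `e` can be allocated when it is minimal for the first two agents. -/
theorem IsEFXAllocation.hasEFX_insert_of_prefers (h : IsEFXAllocation u v w M A B C)
    (hu : ∀ f, 0 ≤ u f) (hv : ∀ f, 0 ≤ v f) (hw : ∀ f, 0 ≤ w f) (heM : e ∉ M)
    (hminu : ∀ f ∈ M, u e ≤ u f) (hminv : ∀ f ∈ M, v e ≤ v f)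
    (hA : ∑ f ∈ A, w f ≤ ∑ f ∈ insert e C, w f) (hAB : ∑ f ∈ A, w f ≤ ∑ f ∈ B, w f)
    (hu' : ∑ f ∈ B, u f ≤ ∑ f ∈ A, u f ∧ ∑ f ∈ B, u f ≤ ∑ f ∈ C, u f ∨
      ∑ f ∈ C, u f ≤ ∑ f ∈ A, u f ∧ ∑ f ∈ C, u f ≤ ∑ f ∈ B, u f)
    (hv' : ∑ f ∈ C, v f ≤ ∑ f ∈ A, v f ∧ ∑ f ∈ C, v f ≤ ∑ f ∈ B, v f ∨
      ∑ f ∈ A, v f ≤ ∑ f ∈ B, v f ∧ ∑ f ∈ A, v f ≤ ∑ f ∈ C, v f) :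
    HasEFX u v w (insert e M) := by
  have hM := h.union_eq
  subst hM
  have heM' := heM
  simp only [mem_union, not_or] at heM'
  obtain ⟨⟨heA, heB⟩, heC⟩ := heM'
  have huC : ∀ f ∈ C, u e ≤ u f := fun f hf => hminu f (by simp [hf])
  have hvC : ∀ f ∈ C, v e ≤ v f := fun f hf => hminv f (by simp [hf])
  rcases hu' with hu' | hu'
  · rcases hv' with hv' | hv'
    · exact ⟨B, insert e C, A,
        { disjoint_AB := disjoint_insert_right.2 ⟨heB, h.disjoint_BC⟩
          disjoint_AC := h.disjoint_AB.symm
          disjoint_BC := disjoint_insert_left.2 ⟨heA, h.disjoint_AC.symm⟩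
          union_eq := by ext; simp only [mem_union, mem_insert]; tauto
          fair_AB := .of_le hu (hu'.2.trans (sum_le_sum_insert hu e C))
          fair_AC := .of_le hu hu'.1
          fair_BA := .insert_of_le heC hvC hv'.2
          fair_BC := .insert_of_le heC hvC hv'.1
          fair_CA := .of_le hw hAB
          fair_CB := .of_le hw hA }⟩
    · have h' : IsEFXAllocation u v w (A ∪ B ∪ C) B A C :=
        { disjoint_AB := h.disjoint_AB.symm
          disjoint_AC := h.disjoint_BC
          disjoint_BC := h.disjoint_AC
          union_eq := by rw [union_comm B A]
          fair_AB := .of_le hu hu'.1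
          fair_AC := .of_le hu hu'.2
          fair_BA := .of_le hv hv'.1
          fair_BC := .of_le hv hv'.2
          fair_CA := h.fair_CB
          fair_CB := h.fair_CA }
      exact ⟨_, _, _, h'.insert_of_le hv hw heM hminu hu'.1 hu'.2⟩
  · exact ⟨insert e C, B, A,
      { disjoint_AB := disjoint_insert_left.2 ⟨heB, h.disjoint_BC.symm⟩
        disjoint_AC := disjoint_insert_left.2 ⟨heA, h.disjoint_AC.symm⟩
        disjoint_BC := h.disjoint_AB.symm
        union_eq := by ext; simp only [mem_union, mem_insert]; tauto
        fair_AB := .insert_of_le heC huC hu'.2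
        fair_AC := .insert_of_le heC huC hu'.1
        fair_BA := h.fair_BC.mono (sum_le_sum_insert hv e C)
        fair_BC := h.fair_BA
        fair_CA := .of_le hw hA
        fair_CB := .of_le hw hAB }⟩

/-- Among three numbers one is a minimum. -/
theorem le_and_le_or_three (x y z : ℝ) :
    (x ≤ y ∧ x ≤ z) ∨ (y ≤ x ∧ y ≤ z) ∨ (z ≤ x ∧ z ≤ y) := by
  grind

/-- A chore that is minimal for two of the three agents can be added to an EFX allocation. -/
theorem HasEFX.insert_of_minimal (h : HasEFX u v w M) (hu : ∀ f, 0 ≤ u f) (hv : ∀ f, 0 ≤ v f)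
    (hw : ∀ f, 0 ≤ w f) (heM : e ∉ M) (hminu : ∀ f ∈ M, u e ≤ u f)
    (hminv : ∀ f ∈ M, v e ≤ v f) : HasEFX u v w (insert e M) := by
  obtain ⟨A, B, C, h⟩ := h
  rcases le_and_le_or_three (∑ f ∈ A, u f) (∑ f ∈ B, u f) (∑ f ∈ C, u f) with hu' | hu'
  · exact ⟨_, _, _, h.insert_of_le hv hw heM hminu hu'.1 hu'.2⟩
  rcases le_and_le_or_three (∑ f ∈ B, v f) (∑ f ∈ C, v f) (∑ f ∈ A, v f) with hv' | hv'
  · exact ⟨_, _, _, (h.swap_left.insert_of_le hu hw heM hminv hv'.2 hv'.1).swap_left⟩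
  replace hv' : ∑ f ∈ C, v f ≤ ∑ f ∈ A, v f ∧ ∑ f ∈ C, v f ≤ ∑ f ∈ B, v f ∨
      ∑ f ∈ A, v f ≤ ∑ f ∈ B, v f ∧ ∑ f ∈ A, v f ≤ ∑ f ∈ C, v f := by tauto
  have hAB := h.disjoint_AB
  have hAC := h.disjoint_AC
  have hBC := h.disjoint_BC
  have hM := h.union_eq
  rcases le_and_le_or_three (∑ f ∈ C, w f) (∑ f ∈ A, w f) (∑ f ∈ B, w f) with hw' | hw' | hw'
  · rcases le_and_le_or_three (∑ f ∈ insert e C, w f) (∑ f ∈ A, w f) (∑ f ∈ B, w f)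
      with hw₂ | hw₂ | hw₂
    · simp only [← hM, mem_union, not_or] at heM
      exact ⟨A, B, insert e C,
        { disjoint_AB := hAB
          disjoint_AC := disjoint_insert_right.2 ⟨heM.1.1, hAC⟩
          disjoint_BC := disjoint_insert_right.2 ⟨heM.1.2, hBC⟩
          union_eq := by rw [union_insert, hM]
          fair_AB := h.fair_AB
          fair_AC := h.fair_AC.mono (sum_le_sum_insert hu e C)
          fair_BA := h.fair_BA
          fair_BC := h.fair_BC.mono (sum_le_sum_insert hv e C)
          fair_CA := .of_le hw hw₂.1
          fair_CB := .of_le hw hw₂.2 }⟩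
    · exact h.hasEFX_insert_of_prefers hu hv hw heM hminu hminv hw₂.1 hw₂.2 hu' hv'
    · exact (h.swap_left.hasEFX_insert_of_prefers hv hu hw heM hminv hminu hw₂.1 hw₂.2
        (by tauto) (by tauto)).swap_left
  · rcases hu' with hu' | hu'
    · rcases hv' with hv' | hv'
      · have h' : IsEFXAllocation u v w M B C A :=
          { disjoint_AB := hBC
            disjoint_AC := hAB.symm
            disjoint_BC := hAC.symm
            union_eq := by rw [← hM]; ext; simp only [mem_union]; tauto
            fair_AB := .of_le hu hu'.2
            fair_AC := .of_le hu hu'.1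
            fair_BA := .of_le hv hv'.2
            fair_BC := .of_le hv hv'.1
            fair_CA := .of_le hw hw'.2
            fair_CB := .of_le hw hw'.1 }
        exact ⟨_, _, _, h'.insert_of_le hv hw heM hminu hu'.2 hu'.1⟩
      · have h' : IsEFXAllocation u v w M B A C :=
          { disjoint_AB := hAB.symm
            disjoint_AC := hBC
            disjoint_BC := hAC
            union_eq := by rw [union_comm B A, hM]
            fair_AB := .of_le hu hu'.1
            fair_AC := .of_le hu hu'.2
            fair_BA := .of_le hv hv'.1
            fair_BC := .of_le hv hv'.2
            fair_CA := h.fair_CB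
            fair_CB := h.fair_CA }
        exact ⟨_, _, _, h'.insert_of_le hv hw heM hminu hu'.1 hu'.2⟩
    · have h' : IsEFXAllocation u v w M C B A :=
        { disjoint_AB := hBC.symm
          disjoint_AC := hAC.symm
          disjoint_BC := hAB.symm
          union_eq := by rw [← hM]; ext; simp only [mem_union]; tauto
          fair_AB := .of_le hu hu'.2
          fair_AC := .of_le hu hu'.1
          fair_BA := h.fair_BC
          fair_BC := h.fair_BA
          fair_CA := .of_le hw hw'.1
          fair_CB := .of_le hw hw'.2 }
      exact ⟨_, _, _, h'.insert_of_le hv hw heM hminu hu'.2 hu'.1⟩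
  · rcases hv' with hv' | hv'
    · have h' : IsEFXAllocation u v w M A C B :=
        { disjoint_AB := hAC
          disjoint_AC := hAB
          disjoint_BC := hBC.symm
          union_eq := by rw [union_right_comm, hM]
          fair_AB := h.fair_AC
          fair_AC := h.fair_AB
          fair_BA := .of_le hv hv'.1
          fair_BC := .of_le hv hv'.2
          fair_CA := .of_le hw hw'.2
          fair_CB := .of_le hw hw'.1 }
      exact ⟨_, _, _, (h'.swap_left.insert_of_le hu hw heM hminv hv'.1 hv'.2).swap_left⟩
    · rcases hu' with hu' | hu'
      · have h' : IsEFXAllocation u v w M B A C :=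
          { disjoint_AB := hAB.symm
            disjoint_AC := hBC
            disjoint_BC := hAC
            union_eq := by rw [union_comm B A, hM]
            fair_AB := .of_le hu hu'.1
            fair_AC := .of_le hu hu'.2
            fair_BA := .of_le hv hv'.1
            fair_BC := .of_le hv hv'.2
            fair_CA := h.fair_CB
            fair_CB := h.fair_CA }
        exact ⟨_, _, _, h'.insert_of_le hv hw heM hminu hu'.1 hu'.2⟩
      · have h' : IsEFXAllocation u v w M C A B :=
          { disjoint_AB := hAC.symm
            disjoint_AC := hBC.symm
            disjoint_BC := hAB
            union_eq := by rw [← hM]; ext; simp only [mem_union]; tauto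
            fair_AB := .of_le hu hu'.1
            fair_AC := .of_le hu hu'.2
            fair_BA := .of_le hv hv'.2
            fair_BC := .of_le hv hv'.1
            fair_CA := .of_le hw hw'.1
            fair_CB := .of_le hw hw'.2 }
        exact ⟨_, _, _, h'.insert_of_le hv hw heM hminu hu'.1 hu'.2⟩

/-- Three chores, each of them maximal for the two agents who do not receive it, can be added to
an EFX allocation. -/
theorem HasEFX.insert_three {x y z : ι} (h : HasEFX u v w M) (hu : ∀ f, 0 ≤ u f)
    (hv : ∀ f, 0 ≤ v f) (hw : ∀ f, 0 ≤ w f) (hx : x ∉ M) (hy : y ∉ M) (hz : z ∉ M)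
    (hxy : x ≠ y) (hxz : x ≠ z) (hyz : y ≠ z)
    (huy : ∀ f, u f ≤ u y) (huz : ∀ f, u f ≤ u z) (hvx : ∀ f, v f ≤ v x)
    (hvz : ∀ f, v f ≤ v z) (hwx : ∀ f, w f ≤ w x) (hwy : ∀ f, w f ≤ w y) :
    HasEFX u v w ({x, y, z} ∪ M) := by
  obtain ⟨A, B, C, h⟩ := h
  have hM := h.union_eq
  subst hM
  simp only [mem_union, not_or] at hx hy hz
  obtain ⟨⟨hxA, hxB⟩, hxC⟩ := hx
  obtain ⟨⟨hyA, hyB⟩, hyC⟩ := hy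
  obtain ⟨⟨hzA, hzB⟩, hzC⟩ := hz
  exact ⟨insert x A, insert y B, insert z C,
    { disjoint_AB := by simp [*, h.disjoint_AB, hxy.symm]
      disjoint_AC := by simp [*, h.disjoint_AC, hxz.symm]
      disjoint_BC := by simp [*, h.disjoint_BC, hyz.symm]
      union_eq := by ext; simp only [mem_union, mem_insert, mem_singleton]; tauto
      fair_AB := h.fair_AB.insert_insert hu hxA hyB (fun f _ => huy f) (huy x)
      fair_AC := h.fair_AC.insert_insert hu hxA hzC (fun f _ => huz f) (huz x)
      fair_BA := h.fair_BA.insert_insert hv hyB hxA (fun f _ => hvx f) (hvx y)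
      fair_BC := h.fair_BC.insert_insert hv hyB hzC (fun f _ => hvz f) (hvz y)
      fair_CA := h.fair_CA.insert_insert hw hzC hxA (fun f _ => hwx f) (hwx z)
      fair_CB := h.fair_CB.insert_insert hw hzC hyB (fun f _ => hwy f) (hwy z) }⟩

/-- Three agents whose costs take only the values `a ≤ b` have an EFX allocation. -/
theorem hasEFX_of_bivalued {a b : ℝ} (ha : 0 ≤ a) (hab : a ≤ b) (hu : ∀ f, u f = a ∨ u f = b)
    (hv : ∀ f, v f = a ∨ v f = b) (hw : ∀ f, w f = a ∨ w f = b) (M : Finset ι) :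
    HasEFX u v w M := by
  have hb : 0 ≤ b := ha.trans hab
  have nonneg {t : ι → ℝ} (ht : ∀ f, t f = a ∨ t f = b) (f : ι) : 0 ≤ t f := by
    rcases ht f with h | h <;> rw [h] <;> assumption
  have le_b {t : ι → ℝ} (ht : ∀ f, t f = a ∨ t f = b) (f : ι) : t f ≤ b := by
    rcases ht f with h | h <;> simp [h, hab]
  have a_le {t : ι → ℝ} (ht : ∀ f, t f = a ∨ t f = b) (f : ι) : a ≤ t f := by
    rcases ht f with h | h <;> simp [h, hab]
  induction M using Finset.strongInduction with
  | H M ih =>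
  rcases M.eq_empty_or_nonempty with rfl | ⟨k, hk⟩
  · exact ⟨∅, ∅, ∅, by constructor <;> simp [EFXToward]⟩
  have exists_min (t : ι → ℝ) : ∃ e ∈ M, ∀ f ∈ M, t e ≤ t f := M.exists_min_image t ⟨k, hk⟩
  by_cases huv : ∃ e ∈ M, (∀ f ∈ M, u e ≤ u f) ∧ ∀ f ∈ M, v e ≤ v f
  · obtain ⟨e, he, h1, h2⟩ := huv
    rw [← insert_erase he]
    exact (ih _ (erase_ssubset he)).insert_of_minimal (nonneg hu) (nonneg hv) (nonneg hw)
      (notMem_erase e M) (fun f hf => h1 f (mem_of_mem_erase hf))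
      fun f hf => h2 f (mem_of_mem_erase hf)
  by_cases huw : ∃ e ∈ M, (∀ f ∈ M, u e ≤ u f) ∧ ∀ f ∈ M, w e ≤ w f
  · obtain ⟨e, he, h1, h2⟩ := huw
    rw [← insert_erase he]
    exact ((ih _ (erase_ssubset he)).swap_right.insert_of_minimal (nonneg hu) (nonneg hw) (nonneg hv)
      (notMem_erase e M) (fun f hf => h1 f (mem_of_mem_erase hf))
      fun f hf => h2 f (mem_of_mem_erase hf)).swap_right
  by_cases hvw : ∃ e ∈ M, (∀ f ∈ M, v e ≤ v f) ∧ ∀ f ∈ M, w e ≤ w f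
  · obtain ⟨e, he, h1, h2⟩ := hvw
    rw [← insert_erase he]
    exact ((ih _ (erase_ssubset he)).swap_left.swap_right.insert_of_minimal (nonneg hv) (nonneg hw)
      (nonneg hu) (notMem_erase e M) (fun f hf => h1 f (mem_of_mem_erase hf))
      fun f hf => h2 f (mem_of_mem_erase hf)).swap_right.swap_left
  obtain ⟨x, hxM, hx⟩ := exists_min u
  obtain ⟨y, hyM, hy⟩ := exists_min v
  obtain ⟨z, hzM, hz⟩ := exists_min w
  have eq_b {t : ι → ℝ} (ht : ∀ f, t f = a ∨ t f = b) {e : ι} (h : ¬ ∀ f ∈ M, t e ≤ t f) :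
      t e = b := (ht e).resolve_left fun h' => h fun f _ => h' ▸ a_le ht f
  have hvx := eq_b hv fun h => huv ⟨x, hxM, hx, h⟩
  have hwx := eq_b hw fun h => huw ⟨x, hxM, hx, h⟩
  have huy := eq_b hu fun h => huv ⟨y, hyM, h, hy⟩
  have hwy := eq_b hw fun h => hvw ⟨y, hyM, hy, h⟩
  have huz := eq_b hu fun h => huw ⟨z, hzM, h, hz⟩
  have hvz := eq_b hv fun h => hvw ⟨z, hzM, h, hz⟩
  have hsub : {x, y, z} ⊆ M := by simp [insert_subset_iff, hxM, hyM, hzM]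
  have h := ih (M \ {x, y, z}) (sdiff_ssubset hsub (by simp))
  rw [← union_sdiff_of_subset hsub]
  refine h.insert_three (nonneg hu) (nonneg hv) (nonneg hw) (by simp) (by simp) (by simp)
    ?_ ?_ ?_ (huy ▸ le_b hu) (huz ▸ le_b hu) (hvx ▸ le_b hv) (hvz ▸ le_b hv) (hwx ▸ le_b hw)
    (hwy ▸ le_b hw)
  · rintro rfl
    exact huv ⟨x, hxM, hx, hy⟩
  · rintro rfl
    exact huw ⟨x, hxM, hx, hz⟩
  · rintro rfl
    exact hvw ⟨y, hyM, hy, hz⟩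

end EFX


/-- For every instance with 3 agents, a finite set `M` of indivisible chores, and
additive bi-valued cost functions (there are constants `a, b ≥ 0` with
`c_i(e) ∈ {a, b}` for every agent `i` and item `e`), there exists an EFX allocation. -/
theorem stmt_12 {ι : Type*} [DecidableEq ι] (M : Finset ι)
    (c : Fin 3 → ι → ℝ) (a b : ℝ) (ha : 0 ≤ a) (hb : 0 ≤ b)
    (hbi : ∀ i, ∀ e ∈ M, c i e = a ∨ c i e = b) :
    ∃ X : Fin 3 → Finset ι,
      (∀ i j, i ≠ j → Disjoint (X i) (X j)) ∧
      (Finset.univ.biUnion X = M) ∧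
      (∀ i j : Fin 3, ∀ e ∈ X i,
        ∑ f ∈ (X i).erase e, c i f ≤ ∑ f ∈ X j, c i f) := by
  have key {a b : ℝ} (ha : 0 ≤ a) (hab : a ≤ b) (hbi : ∀ i, ∀ e ∈ M, c i e = a ∨ c i e = b) :
      HasEFX (fun e => if e ∈ M then c 0 e else a) (fun e => if e ∈ M then c 1 e else a)
        (fun e => if e ∈ M then c 2 e else a) M := by
    refine hasEFX_of_bivalued ha hab ?_ ?_ ?_ M <;> intro f <;> by_cases hf : f ∈ M <;>
      simp [hf, hbi]
  obtain ⟨d, A, B, C, h⟩ : ∃ d : ℝ, HasEFX (fun e => if e ∈ M then c 0 e else d)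
      (fun e => if e ∈ M then c 1 e else d) (fun e => if e ∈ M then c 2 e else d) M := by
    rcases le_total a b with hab | hab
    · exact ⟨a, key ha hab hbi⟩
    · exact ⟨b, key hb hab fun i e he => (hbi i e he).symm⟩
  have hAM : A ⊆ M := h.union_eq ▸ fun f hf => by simp [hf]
  have hBM : B ⊆ M := h.union_eq ▸ fun f hf => by simp [hf]
  have hCM : C ⊆ M := h.union_eq ▸ fun f hf => by simp [hf]
  have sum_eq (i : Fin 3) {S : Finset ι} (hS : S ⊆ M) :
      ∑ f ∈ S, (if f ∈ M then c i f else d) = ∑ f ∈ S, c i f :=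
    sum_congr rfl fun f hf => if_pos (hS hf)
  have fair (i : Fin 3) {S T : Finset ι} (hS : S ⊆ M) (hT : T ⊆ M)
      (h : EFXToward (fun e => if e ∈ M then c i e else d) S T) : EFXToward (c i) S T := by
    intro e he
    rw [← sum_eq i hT, ← sum_eq i ((erase_subset e S).trans hS)]
    exact h e he
  have hc : ∀ i e, e ∈ M → 0 ≤ c i e := fun i e he => by
    rcases hbi i e he with h | h <;> rw [h] <;> assumption
  have refl (i : Fin 3) {S : Finset ι} (hS : S ⊆ M) : EFXToward (c i) S S := fun e _ =>
    sum_le_sum_of_subset_of_nonneg (erase_subset e S) fun f hf _ => hc i f (hS hf)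
  refine ⟨![A, B, C], ?_, ?_, ?_⟩
  · intro i j hij
    fin_cases i <;> fin_cases j <;>
      first
      | exact absurd rfl hij
      | exact h.disjoint_AB
      | exact h.disjoint_AC
      | exact h.disjoint_BC
      | exact h.disjoint_AB.symm
      | exact h.disjoint_AC.symm
      | exact h.disjoint_BC.symm
  · rw [← h.union_eq]
    ext f
    simp [Fin.exists_fin_succ]
  · intro i j
    fin_cases i <;> fin_cases j
    · exact refl 0 hAM
    · exact fair 0 hAM hBM h.fair_AB
    · exact fair 0 hAM hCM h.fair_AC
    · exact fair 1 hBM hAM h.fair_BA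
    · exact refl 1 hBM
    · exact fair 1 hBM hCM h.fair_BC
    · exact fair 2 hCM hAM h.fair_CA
    · exact fair 2 hCM hBM h.fair_CB
    · exact refl 2 hCM
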